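/- Fix an integer d ≥ 2 and a finite (possibly empty) set Σ of primes. Let W_Σ := {C ∈ 𝒫 : p does not divide 𝔯(C) for every p ∈ Σ, and p^{2d} does not divide 𝔯(C) for every prime p} (i.e., rational maps of degree d with 2d-power-free resultant and good reduction at all primes in Σ). Then the height density of W_Σ exists and is strictly positive: lim_{x→∞} #W_Σ(x)/#𝒫(x) exists and is > 0. -/

import Mathlib

open Filter MvPolynomial

noncomputable section

/-- The `2d × 2d` Sylvester matrix of the two generic binary forms of degree `d`,
with entries taken from the coordinates of `Q` (the first `d+1` coordinates of `Q`
are the coefficients of `F`, the last `d+1` ones those of `G`). -/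
def sylvesterMat (d : ℕ) {R : Type*} [CommRing R] (Q : Fin (2 * d + 2) → R) :
    Matrix (Fin (2 * d)) (Fin (2 * d)) R :=
  Matrix.of fun i j =>
    if hi : (i : ℕ) < d then
      if h : (i : ℕ) ≤ (j : ℕ) ∧ (j : ℕ) ≤ (i : ℕ) + d then
        Q ⟨(j : ℕ) - (i : ℕ), by omega⟩
      else 0
    else
      if h : (i : ℕ) - d ≤ (j : ℕ) ∧ (j : ℕ) ≤ (i : ℕ) then
        Q ⟨d + 1 + ((j : ℕ) - ((i : ℕ) - d)), by omega⟩
      else 0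

/-- The generic resultant polynomial `𝔯 ∈ ℤ[x₀,…,x_d,y₀,…,y_d]`:
the determinant of the Sylvester matrix of the generic binary forms of degree `d`. -/
def resPoly (d : ℕ) : MvPolynomial (Fin (2 * d + 2)) ℤ :=
  Matrix.det (sylvesterMat d fun i => X i)

/-- Evaluation `𝔯(Q)` of the generic resultant at a tuple `Q` with entries in a
commutative ring (i.e. evaluation of the image of `𝔯` under the coefficient map `ℤ → R`). -/
def resEval (d : ℕ) {R : Type*} [CommRing R] (Q : Fin (2 * d + 2) → R) : R :=
  aeval Q (resPoly d)

/-- The set `𝒫 ⊆ ℤ^{2d+2}` identified with `ℙ^{2d+1}(ℚ)`: integer tuples with gcd `1`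
whose first nonzero coordinate is positive. -/
def projPts (d : ℕ) : Set (Fin (2 * d + 2) → ℤ) :=
  {C | Finset.univ.gcd C = 1 ∧ ∃ i, 0 < C i ∧ ∀ j, j < i → C j = 0}

/-- The box of integer tuples with `|xᵢ| ≤ rᵢ` for all `i`. -/
def box {m : ℕ} (r : Fin m → ℝ) : Set (Fin m → ℤ) :=
  {x | ∀ i, |(x i : ℝ)| ≤ r i}

/-- The value `ζ(k)` of the Riemann zeta function at an integer `k` (for `k ≥ 2`). -/
def zetaVal (k : ℕ) : ℝ := ∑' n : ℕ+, (1 : ℝ) / ((n : ℕ) : ℝ) ^ k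

/-- The local factor `π_p^{(k)}`. -/
def piLocal (d p k : ℕ) : ℝ :=
  (Nat.card {Q : Fin (2 * d + 2) → ZMod (p ^ k) // resEval d Q ≠ 0} : ℝ) /
    ((p : ℝ) ^ ((2 * d + 2) * k) * (1 - 1 / (p : ℝ) ^ (2 * d + 2)))

/-- The set `W_Σ`: tuples in `𝒫` with `2d`-power free resultant and resultant
not divisible by any `p ∈ Σ` (good reduction at `Σ`). -/
def WSigma (d : ℕ) (Sig : Finset ℕ) : Set (Fin (2 * d + 2) → ℤ) :=
  {C | C ∈ projPts d ∧ (∀ p ∈ Sig, ¬ (p : ℤ) ∣ resEval d C) ∧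
    ∀ p : ℕ, p.Prime → ¬ (p : ℤ) ^ (2 * d) ∣ resEval d C}


section Resultant

theorem resEval_eq_det (d : ℕ) {R : Type*} [CommRing R] (Q : Fin (2 * d + 2) → R) :
    resEval d Q = (sylvesterMat d Q).det := by
  unfold resEval resPoly
  rw [AlgHom.map_det]
  congr 1
  ext i j
  simp only [sylvesterMat, AlgHom.mapMatrix_apply, Matrix.map_apply, Matrix.of_apply]
  split_ifs <;> simp

theorem map_resEval {R S : Type*} [CommRing R] [CommRing S] (d : ℕ) (f : R →+* S)
    (Q : Fin (2 * d + 2) → R) : f (resEval d Q) = resEval d (fun i => f (Q i)) := by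
  rw [resEval_eq_det, resEval_eq_det, RingHom.map_det]
  congr 1
  ext i j
  simp only [sylvesterMat, RingHom.mapMatrix_apply, Matrix.map_apply, Matrix.of_apply]
  split_ifs <;> simp

theorem resEval_smul (d : ℕ) {R : Type*} [CommRing R] (c : R) (Q : Fin (2 * d + 2) → R) :
    resEval d (c • Q) = c ^ (2 * d) * resEval d Q := by
  have h : sylvesterMat d (c • Q) = c • sylvesterMat d Q := by
    ext i j
    simp only [sylvesterMat, Matrix.of_apply, Matrix.smul_apply, smul_eq_mul, Pi.smul_apply]
    split_ifs <;> simp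
  rw [resEval_eq_det, resEval_eq_det, h, Matrix.det_smul, Fintype.card_fin]

theorem resEval_neg (d : ℕ) (C : Fin (2 * d + 2) → ℤ) : resEval d (-C) = resEval d C := by
  rw [← neg_one_smul ℤ C, resEval_smul]
  simp

theorem pow_dvd_resEval (d : ℕ) {p : ℤ} {C : Fin (2 * d + 2) → ℤ} (h : ∀ i, p ∣ C i) :
    p ^ (2 * d) ∣ resEval d C := by
  choose D hD using h
  have : C = p • D := funext hD
  rw [this, resEval_smul]
  exact dvd_mul_right _ _

theorem resEval_modEq (d : ℕ) {N : ℕ} {C D : Fin (2 * d + 2) → ℤ}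
    (h : ∀ i, (C i : ZMod N) = D i) : ((resEval d C : ℤ) : ZMod N) = (resEval d D : ℤ) := by
  have h1 := map_resEval d (Int.castRingHom (ZMod N)) C
  have h2 := map_resEval d (Int.castRingHom (ZMod N)) D
  simp only [eq_intCast] at h1 h2
  rw [h1, h2]
  simp only [h]

theorem abs_resEval_le (d : ℕ) {C : Fin (2 * d + 2) → ℤ} {x : ℤ} (h : ∀ i, |C i| ≤ x) :
    |resEval d C| ≤ ((2 * d).factorial : ℤ) * x ^ (2 * d) := by
  have h0 : 0 ≤ x := (abs_nonneg _).trans (h 0)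
  rw [resEval_eq_det]
  have := Matrix.det_le (abv := AbsoluteValue.abs) (A := sylvesterMat d C) (x := x) (fun i j => by
    simp only [sylvesterMat, Matrix.of_apply, AbsoluteValue.abs_apply]
    split_ifs <;> simp [h, h0])
  simpa [Fintype.card_fin, nsmul_eq_mul] using this

/-- The coefficient tuple of the map `[X ^ d : Y ^ d]`, up to swapping coordinates. -/
def powTuple (d : ℕ) : Fin (2 * d + 2) → ℤ := fun i => if i = 0 ∨ i = Fin.last _ then 1 else 0

theorem prod_ite_val_lt {R : Type*} [CommRing R] (d : ℕ) (x y : R) :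
    ∏ i : Fin (2 * d), (if (i : ℕ) < d then x else y) = x ^ d * y ^ d := by
  rw [Fin.prod_univ_eq_prod_range (fun i => if i < d then x else y) (2 * d),
    two_mul, Finset.prod_range_add]
  congr 1
  · rw [Finset.prod_congr rfl (g := fun _ => x)]
    · simp
    · intro i hi
      simp [Finset.mem_range.1 hi]
  · simp

theorem resEval_of_upper (d : ℕ) {R : Type*} [CommRing R] (Q : Fin (2 * d + 2) → R)
    (h : ∀ i : Fin (2 * d + 2), d < i → i ≠ Fin.last _ → Q i = 0) :
    resEval d Q = Q 0 ^ d * Q (Fin.last _) ^ d := by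
  rw [resEval_eq_det, Matrix.det_of_isUpperTriangular]
  · have e : ∀ i : Fin (2 * d), sylvesterMat d Q i i =
        if (i : ℕ) < d then Q 0 else Q (Fin.last _) := by
      intro i
      simp only [sylvesterMat, Matrix.of_apply]
      split_ifs with h1 h2 h3
      · congr 1
        ext
        simp
      · omega
      · congr 1
        ext
        simp
        omega
      · omega
    simp only [e]
    rw [prod_ite_val_lt]
  · intro i j hij
    have hij' : (j : ℕ) < i := hij
    simp only [sylvesterMat, Matrix.of_apply]
    split_ifs with h1 h2 h3
    · omega
    · rfl
    · apply h
      · simp; omega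
      · intro hc
        have := congrArg Fin.val hc
        simp at this
        omega
    · rfl

theorem resEval_of_lower (d : ℕ) {R : Type*} [CommRing R] (Q : Fin (2 * d + 2) → R)
    (h : ∀ i : Fin (2 * d + 2), (i : ℕ) ≤ d → i ≠ 0 → Q i = 0) :
    resEval d Q = Q 0 ^ d * Q (Fin.last _) ^ d := by
  rw [resEval_eq_det, Matrix.det_of_isLowerTriangular]
  · have e : ∀ i : Fin (2 * d), sylvesterMat d Q i i =
        if (i : ℕ) < d then Q 0 else Q (Fin.last _) := by
      intro i
      simp only [sylvesterMat, Matrix.of_apply]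
      split_ifs with h1 h2 h3
      · congr 1
        ext
        simp
      · omega
      · congr 1
        ext
        simp
        omega
      · omega
    simp only [e]
    rw [prod_ite_val_lt]
  · intro i j hij
    have hij' : (i : ℕ) < j := hij
    simp only [sylvesterMat, Matrix.of_apply]
    split_ifs with h1 h2 h3
    · apply h
      · simp; omega
      · intro hc
        have := congrArg Fin.val hc
        simp at this
        omega
    · rfl
    · omega
    · rfl

theorem resEval_powTuple (d : ℕ) : resEval d (powTuple d) = 1 := by
  rw [resEval_of_upper]
  · simp [powTuple]
  · intro i hi hl
    have : i ≠ 0 := by rintro rfl; simp at hi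
    simp [powTuple, hl, this]

theorem natDegree_le_and_coeff_of_pow_mul {m : Type*} [Fintype m] [DecidableEq m] {d : ℕ}
    (hm : Fintype.card m = 2 * d) (P : Polynomial ℤ) (A B : Matrix m m ℤ)
    (h : Polynomial.X ^ d * P =
      ((Polynomial.X : Polynomial ℤ) • A.map Polynomial.C + B.map Polynomial.C).det) :
    P.natDegree ≤ d ∧ P.coeff d = A.det := by
  have hdeg := Polynomial.natDegree_det_X_add_C_le A B
  have hc := Polynomial.coeff_det_X_add_C_card A B
  rw [← h, hm] at hdeg hc
  rw [two_mul, Polynomial.coeff_X_pow_mul] at hc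
  refine ⟨?_, hc⟩
  by_cases hP : P = 0
  · simp [hP]
  rw [Polynomial.natDegree_X_pow_mul d hP] at hdeg
  omega

theorem exists_polynomial_update_last (d : ℕ) (C : Fin (2 * d + 2) → ℤ) :
    ∃ P : Polynomial ℤ, P.natDegree ≤ d ∧ P.coeff d = C 0 ^ d ∧
      ∀ t, P.eval t = resEval d (Function.update C (Fin.last _) t) := by
  set U : Fin (2 * d + 2) → Polynomial ℤ :=
    Function.update (fun i => Polynomial.C (C i)) (Fin.last _) Polynomial.X with hU
  set A : Fin (2 * d + 2) → ℤ := fun i => if i = Fin.last _ then 1 else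
    if (i : ℕ) ≤ d then C i else 0 with hA
  set B : Fin (2 * d + 2) → ℤ := fun i => if i = Fin.last _ then 0 else
    if (i : ℕ) ≤ d then 0 else C i with hB
  have key := natDegree_le_and_coeff_of_pow_mul (d := d) (Fintype.card_fin _) (resEval d U)
    (sylvesterMat d A) (sylvesterMat d B) (by
      have hX : (Polynomial.X : Polynomial ℤ) ^ d = Polynomial.X ^ d * 1 ^ d := by simp
      rw [resEval_eq_det, hX, ← prod_ite_val_lt, ← Matrix.det_diagonal, ← Matrix.det_mul]
      congr 1
      ext1 i j
      simp only [Matrix.diagonal_mul, Matrix.add_apply, Matrix.smul_apply, Matrix.map_apply,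
        sylvesterMat, Matrix.of_apply, smul_eq_mul, hA, hB, hU, Function.update_apply]
      simp only [Fin.ext_iff, Fin.val_last]
      split_ifs <;> first | omega | simp)
  refine ⟨resEval d U, key.1, ?_, ?_⟩
  · rw [key.2, ← resEval_eq_det, resEval_of_upper]
    · simp [hA, Fin.ext_iff]
    · intro i hi hl
      simp [hA, hl, hi]
  · intro t
    have := map_resEval d (Polynomial.evalRingHom t) U
    rw [Polynomial.coe_evalRingHom] at this
    rw [this]
    congr 1
    ext i
    by_cases hi : i = Fin.last _
    · subst hi; simp [hU]
    · simp [hU, hi]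

theorem exists_polynomial_update_zero (d : ℕ) (C : Fin (2 * d + 2) → ℤ) :
    ∃ P : Polynomial ℤ, P.natDegree ≤ d ∧ P.coeff d = C (Fin.last _) ^ d ∧
      ∀ t, P.eval t = resEval d (Function.update C 0 t) := by
  set U : Fin (2 * d + 2) → Polynomial ℤ :=
    Function.update (fun i => Polynomial.C (C i)) 0 Polynomial.X with hU
  set A : Fin (2 * d + 2) → ℤ := fun i => if i = 0 then 1 else
    if (i : ℕ) ≤ d then 0 else C i with hA
  set B : Fin (2 * d + 2) → ℤ := fun i => if i = 0 then 0 else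
    if (i : ℕ) ≤ d then C i else 0 with hB
  have key := natDegree_le_and_coeff_of_pow_mul (d := d) (Fintype.card_fin _) (resEval d U)
    (sylvesterMat d A) (sylvesterMat d B) (by
      have hX : (Polynomial.X : Polynomial ℤ) ^ d = 1 ^ d * Polynomial.X ^ d := by simp
      rw [resEval_eq_det, hX, ← prod_ite_val_lt, ← Matrix.det_diagonal, ← Matrix.det_mul]
      congr 1
      ext1 i j
      simp only [Matrix.diagonal_mul, Matrix.add_apply, Matrix.smul_apply, Matrix.map_apply,
        sylvesterMat, Matrix.of_apply, smul_eq_mul, hA, hB, hU, Function.update_apply]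
      simp only [Fin.ext_iff, Fin.val_zero]
      split_ifs <;> first | omega | simp)
  refine ⟨resEval d U, key.1, ?_, ?_⟩
  · rw [key.2, ← resEval_eq_det, resEval_of_lower]
    · have h0 : Fin.last (2 * d + 1) ≠ 0 := Fin.last_pos.ne'
      have h1 : ¬ 2 * d + 1 ≤ d := by omega
      simp [hA, h0, h1]
    · intro i hi hl
      simp [hA, hl, hi]
  · intro t
    have := map_resEval d (Polynomial.evalRingHom t) U
    rw [Polynomial.coe_evalRingHom] at this
    rw [this]
    congr 1
    ext i
    by_cases hi : i = 0
    · subst hi; simp [hU]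
    · simp [hU, hi]

end Resultant

section LocalCount

theorem pow_dvd_of_pow_succ_dvd_mul {p : ℕ} (hp : p.Prime) {k : ℕ} {u v : ℤ}
    (h : (p : ℤ) ^ (k + 1) ∣ u * v) (hu : ¬ (p : ℤ) ^ 2 ∣ u) : (p : ℤ) ^ k ∣ v := by
  have hp' : Prime (p : ℤ) := Nat.prime_iff_prime_int.1 hp
  by_cases h1 : (p : ℤ) ∣ u
  · obtain ⟨w, rfl⟩ := h1
    have hw : ¬ (p : ℤ) ∣ w := fun hw => hu (by rw [pow_two]; exact mul_dvd_mul_left _ hw)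
    rw [pow_succ', mul_assoc] at h
    have h2 := (mul_dvd_mul_iff_left hp'.ne_zero).1 h
    exact hp'.pow_dvd_of_dvd_mul_left k hw h2
  · exact (pow_dvd_pow _ k.le_succ).trans (hp'.pow_dvd_of_dvd_mul_left (k + 1) h1 h)

/-- A polynomial of degree at most `d` whose coefficient of degree `d` is prime to `p` takes values
divisible by `p ^ (d + 1)` on at most `d` residue classes modulo `p ^ 2`. -/
theorem card_le_of_pow_dvd_eval {p : ℕ} (hp : p.Prime) (d : ℕ) (f : Polynomial ℤ)
    (hf : f.natDegree ≤ d) (hc : ¬ (p : ℤ) ∣ f.coeff d) (s : Finset ℤ)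
    (hs : ∀ t ∈ s, (p : ℤ) ^ (d + 1) ∣ f.eval t)
    (hinj : ∀ t ∈ s, ∀ u ∈ s, (p : ℤ) ^ 2 ∣ t - u → t = u) : s.card ≤ d := by
  induction d generalizing f s with
  | zero =>
    rw [Nat.le_zero, Finset.card_eq_zero, Finset.eq_empty_iff_forall_notMem]
    intro t ht
    have h := hs t ht
    rw [Polynomial.eq_C_of_natDegree_le_zero hf, Polynomial.eval_C, zero_add, pow_one] at h
    exact hc h
  | succ d ih =>
    rcases s.eq_empty_or_nonempty with rfl | ⟨a, ha⟩
    · simp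
    set g := f /ₘ (Polynomial.X - Polynomial.C a) with hg
    have hfg : (Polynomial.X - Polynomial.C a) * g = f - Polynomial.C (f.eval a) := by
      rw [hg, Polynomial.X_sub_C_mul_divByMonic_eq_sub_modByMonic,
        Polynomial.modByMonic_X_sub_C_eq_C_eval]
    have hgd : g.natDegree ≤ d := by
      rw [hg, Polynomial.natDegree_divByMonic _ (Polynomial.monic_X_sub_C a),
        Polynomial.natDegree_X_sub_C]
      omega
    have hgc : g.coeff d = f.coeff (d + 1) := by
      have := congrArg (fun q => Polynomial.coeff q (d + 1)) hfg
      simp only [sub_mul, Polynomial.coeff_sub, Polynomial.coeff_X_mul, Polynomial.coeff_C_mul,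
        Polynomial.coeff_C_succ, sub_zero] at this
      rw [Polynomial.coeff_eq_zero_of_natDegree_lt (n := d + 1) (by omega)] at this
      simpa using this
    have := ih g hgd (by rwa [hgc]) (s.erase a) (by
      intro t ht
      have hta := Finset.ne_of_mem_erase ht
      have ht' := Finset.mem_of_mem_erase ht
      have he := congrArg (Polynomial.eval t) hfg
      simp only [Polynomial.eval_mul, Polynomial.eval_sub, Polynomial.eval_X,
        Polynomial.eval_C] at he
      refine pow_dvd_of_pow_succ_dvd_mul hp (u := t - a) ?_ fun h => hta (hinj t ht' a ha h)
      rw [he]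
      exact dvd_sub (hs t ht') (hs a ha))
      (fun t ht u hu => hinj t (Finset.mem_of_mem_erase ht) u (Finset.mem_of_mem_erase hu))
    rw [Finset.card_erase_of_mem ha] at this
    omega

/-- The symmetric interval `[-H, H]` of integers. -/
abbrev symIcc (H : ℕ) : Finset ℤ := Finset.Icc (-(H : ℤ)) H

theorem card_symIcc (H : ℕ) : (symIcc H).card = 2 * H + 1 := by
  rw [symIcc, Int.card_Icc]
  omega

theorem card_filter_dvd_sub_le (H r : ℕ) (hr : 0 < r) (v : ℤ) :
    ((symIcc H).filter fun t => (r : ℤ) ∣ t - v).card ≤ (2 * H + 1) / r + 1 := by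
  have hinj : Set.InjOn (fun t : ℤ => ((t + H) / r).toNat)
      ((symIcc H).filter fun t => (r : ℤ) ∣ t - v : Finset ℤ) := by
    intro t ht u hu htu
    simp only [Finset.coe_filter, Finset.mem_Icc, Set.mem_ofPred_eq] at ht hu htu
    have hr' : (0 : ℤ) < r := by exact_mod_cast hr
    have h1 : 0 ≤ (t + H) / r := Int.ediv_nonneg (by omega) hr'.le
    have h2 : 0 ≤ (u + H) / r := Int.ediv_nonneg (by omega) hr'.le
    have h3 : (t + H) / r = (u + H) / r := by omega
    have h4 : (t + H) % r = (u + H) % r := by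
      rw [Int.emod_eq_emod_iff_emod_sub_eq_zero]
      apply Int.emod_eq_zero_of_dvd
      have := dvd_sub ht.2 hu.2
      simpa using this
    have h5 := Int.mul_ediv_add_emod (t + H) r
    have h6 := Int.mul_ediv_add_emod (u + H) r
    rw [h3, h4] at h5
    omega
  calc _ ≤ (Finset.range ((2 * H + 1) / r + 1)).card := by
        refine Finset.card_le_card_of_injOn _ ?_ hinj
        intro t ht
        simp only [Finset.coe_filter, Finset.mem_Icc, Set.mem_ofPred_eq] at ht
        simp only [Finset.coe_range, Set.mem_Iio, Nat.lt_succ_iff]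
        have hr' : (0 : ℤ) < r := by exact_mod_cast hr
        have : (t + H) / r ≤ (2 * H + 1) / r := Int.ediv_le_ediv hr' (by omega)
        have : ((t + H) / r).toNat ≤ ((2 * H + 1 : ℤ) / r).toNat := Int.toNat_le_toNat this
        refine this.trans (le_of_eq ?_)
        norm_cast
    _ = _ := Finset.card_range _

theorem card_filter_pow_dvd_eval_le {p : ℕ} (hp : p.Prime) (d : ℕ) (f : Polynomial ℤ)
    (hf : f.natDegree ≤ d) (hc : ¬ (p : ℤ) ∣ f.coeff d) (H : ℕ) :
    ((symIcc H).filter fun t => (p : ℤ) ^ (d + 1) ∣ f.eval t).card ≤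
      d * ((2 * H + 1) / p ^ 2 + 1) := by
  set S := (symIcc H).filter fun t => (p : ℤ) ^ (d + 1) ∣ f.eval t with hS
  set q : ℤ := (p : ℤ) ^ 2 with hq
  obtain ⟨T, hTS, hinj, himg⟩ := Finset.exists_subset_injOn_image_eq_of_surjOn
    (f := fun t : ℤ => t % q) S (S.image fun t => t % q) (by
      intro y hy
      simpa using hy)
  have hT : T.card ≤ d := card_le_of_pow_dvd_eval hp d f hf hc T
    (fun t ht => (Finset.mem_filter.1 (hTS ht)).2)
    (fun t ht u hu h => hinj ht hu 
      (Int.emod_eq_emod_iff_emod_sub_eq_zero.2 (Int.emod_eq_zero_of_dvd h)))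
  have himgc : (S.image fun t => t % q).card ≤ d := by
    rw [← himg]
    exact Finset.card_image_le.trans hT
  refine (Finset.card_le_mul_card_image (f := fun t : ℤ => t % q) S
    ((2 * H + 1) / p ^ 2 + 1) ?_).trans ?_
  · intro y hy
    refine (Finset.card_le_card ?_).trans
      (card_filter_dvd_sub_le H (p ^ 2) (pow_pos hp.pos 2) y)
    intro t ht
    simp only [hS, Finset.mem_filter] at ht ⊢
    refine ⟨ht.1.1, ?_⟩
    push_cast
    rw [← ht.2]
    exact Int.dvd_self_sub_emod
  · rw [mul_comm]
    exact Nat.mul_le_mul_right _ himgc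

/-- The cube `[-H, H] ^ ι` of integer points. -/
abbrev cube (ι : Type*) [Fintype ι] [DecidableEq ι] (H : ℕ) : Finset (ι → ℤ) :=
  Fintype.piFinset fun _ => symIcc H

theorem card_cube (ι : Type*) [Fintype ι] [DecidableEq ι] (H : ℕ) :
    (cube ι H).card = (2 * H + 1) ^ Fintype.card ι := by
  rw [cube, Fintype.card_piFinset, Finset.prod_const, card_symIcc, Finset.card_univ]

theorem card_le_of_card_fiber_le {ι : Type*} [Fintype ι] [DecidableEq ι] (i : ι) (H K : ℕ)
    (S : Finset (ι → ℤ)) (hS : S ⊆ cube ι H)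
    (hK : ∀ g : ι → ℤ, ((symIcc H).filter fun t => Function.update g i t ∈ S).card ≤ K) :
    S.card ≤ K * (2 * H + 1) ^ (Fintype.card ι - 1) := by
  have hc : (cube {j : ι // j ≠ i} H).card = (2 * H + 1) ^ (Fintype.card ι - 1) := by
    rw [card_cube]
    congr 1
    rw [Fintype.card_subtype_compl, Fintype.card_subtype_eq]
  rw [← hc]
  refine Finset.card_le_mul_card_image_of_maps_to (f := fun g (j : {j : ι // j ≠ i}) => g j) ?_ K ?_
  · intro g hg
    have := hS hg
    simp only [Fintype.mem_piFinset] at this ⊢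
    exact fun j => this j
  · intro y _
    rcases (S.filter fun g => (fun j : {j : ι // j ≠ i} => g j) = y).eq_empty_or_nonempty with
      h | ⟨g₀, hg₀⟩
    · simp [h]
    refine le_trans ?_ (hK g₀)
    have hupd : ∀ g ∈ S.filter fun g => (fun j : {j : ι // j ≠ i} => g j) = y,
        Function.update g₀ i (g i) = g := by
      intro g hg
      ext j
      by_cases hj : j = i
      · subst hj; simp
      · rw [Function.update_of_ne hj]
        have h1 := (Finset.mem_filter.1 hg).2
        have h2 := (Finset.mem_filter.1 hg₀).2
        exact congrFun (h2.trans h1.symm) ⟨j, hj⟩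
    refine Finset.card_le_card_of_injOn (fun g => g i) ?_ ?_
    · intro g hg
      have hgS := (Finset.mem_filter.1 hg).1
      simp only [Finset.coe_filter, Set.mem_ofPred_eq]
      refine ⟨(Fintype.mem_piFinset.1 (hS hgS)) i, ?_⟩
      rw [hupd g hg]
      exact hgS
    · intro g hg g' hg' h
      rw [← hupd g hg, ← hupd g' hg']
      simp only at h
      rw [h]

theorem card_le_of_two_coordinates {ι : Type*} [Fintype ι] [DecidableEq ι] {a b : ι} (hab : a ≠ b)
    (H K : ℕ) (u v : ℤ → Prop) [DecidablePred u] [DecidablePred v]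
    (hu : ((symIcc H).filter u).card ≤ K) (hv : ((symIcc H).filter v).card ≤ K) :
    ((cube ι H).filter fun g => u (g a) ∧ v (g b)).card ≤
      K ^ 2 * (2 * H + 1) ^ (Fintype.card ι - 2) := by
  set I : ι → Finset ℤ := fun i => if i = a then (symIcc H).filter u else
    if i = b then (symIcc H).filter v else symIcc H with hI
  have hsub : ((cube ι H).filter fun g => u (g a) ∧ v (g b)) ⊆ Fintype.piFinset I := by
    intro g hg
    rw [Finset.mem_filter, Fintype.mem_piFinset] at hg
    rw [Fintype.mem_piFinset]
    intro i
    simp only [hI]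
    split_ifs with h1 h2
    · subst h1; exact Finset.mem_filter.2 ⟨hg.1 _, hg.2.1⟩
    · subst h2; exact Finset.mem_filter.2 ⟨hg.1 _, hg.2.2⟩
    · exact hg.1 i
  refine (Finset.card_le_card hsub).trans ?_
  rw [Fintype.card_piFinset]
  have hsplit : ∀ f : ι → ℕ, ∏ i, f i = f a * (f b * ∏ i ∈ (Finset.univ.erase a).erase b, f i) := by
    intro f
    rw [Finset.mul_prod_erase _ f (Finset.mem_erase.2 ⟨hab.symm, Finset.mem_univ b⟩),
      Finset.mul_prod_erase _ f (Finset.mem_univ a)]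
  rw [hsplit, Finset.prod_congr rfl (g := fun _ => 2 * H + 1), Finset.prod_const,
    Finset.card_erase_of_mem (Finset.mem_erase.2 ⟨hab.symm, Finset.mem_univ b⟩),
    Finset.card_erase_of_mem (Finset.mem_univ a), Finset.card_univ, ← mul_assoc, pow_two]
  · refine Nat.mul_le_mul (Nat.mul_le_mul ?_ ?_) (le_of_eq ?_)
    · simpa [hI] using hu
    · simpa [hI, hab.symm] using hv
    · congr 1
  · intro i hi
    simp only [Finset.mem_erase] at hi
    simp only [hI, hi.1, hi.2.1, if_false]
    exact card_symIcc H

end LocalCount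

section PrimeCount

theorem natDegree_comp_affine_le {d : ℕ} {P : Polynomial ℤ} (hP : P.natDegree ≤ d) (c : ℤ) {Q : ℤ}
    (hQ : Q ≠ 0) : (P.comp (Polynomial.C Q * Polynomial.X + Polynomial.C c)).natDegree ≤ d ∧
      (P.comp (Polynomial.C Q * Polynomial.X + Polynomial.C c)).coeff d = P.coeff d * Q ^ d := by
  have hdeg : (P.comp (Polynomial.C Q * Polynomial.X + Polynomial.C c)).natDegree = P.natDegree := by
    rw [Polynomial.natDegree_comp, Polynomial.natDegree_linear hQ, mul_one]
  refine ⟨hdeg.trans_le hP, ?_⟩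
  rcases hP.lt_or_eq with h | rfl
  · rw [Polynomial.coeff_eq_zero_of_natDegree_lt h,
      Polynomial.coeff_eq_zero_of_natDegree_lt (hdeg.trans_lt h), zero_mul]
  · have := Polynomial.leadingCoeff_comp (p := P)
      (q := Polynomial.C Q * Polynomial.X + Polynomial.C c)
      (by rw [Polynomial.natDegree_linear hQ]; exact one_ne_zero)
    rw [Polynomial.leadingCoeff, hdeg, Polynomial.leadingCoeff_linear hQ] at this
    exact this

/-- The points of the lattice coset `c + Q ℤ ^ ι`. -/
def cosetPoint {ι : Type*} (c : ι → ℤ) (Q : ℕ) (g : ι → ℤ) : ι → ℤ := fun i => Q * g i + c i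

theorem cosetPoint_update {ι : Type*} [DecidableEq ι] (c : ι → ℤ) (Q : ℕ) (g : ι → ℤ) (i : ι)
    (t : ℤ) : cosetPoint c Q (Function.update g i t) =
      Function.update (cosetPoint c Q g) i (Q * t + c i) := by
  ext j
  by_cases hj : j = i
  · subst hj; simp [cosetPoint]
  · simp [cosetPoint, hj]

theorem card_filter_dvd_affine_le {p : ℕ} (hp : p.Prime) {Q : ℕ} (hQ : ¬ p ∣ Q) (c : ℤ) (H : ℕ) :
    ((symIcc H).filter fun t => (p : ℤ) ∣ Q * t + c).card ≤ (2 * H + 1) / p + 1 := by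
  rcases ((symIcc H).filter fun t => (p : ℤ) ∣ Q * t + c).eq_empty_or_nonempty with h | ⟨v, hv⟩
  · simp [h]
  refine (Finset.card_le_card ?_).trans (card_filter_dvd_sub_le H p hp.pos v)
  intro t ht
  rw [Finset.mem_filter] at ht hv ⊢
  refine ⟨ht.1, ?_⟩
  have h := dvd_sub ht.2 hv.2
  have h' : (p : ℤ) ∣ Q * (t - v) := by
    have e : (Q : ℤ) * (t - v) = Q * t + c - (Q * v + c) := by ring
    rwa [e]
  refine ((Nat.prime_iff_prime_int.1 hp).dvd_or_dvd h').resolve_left ?_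
  exact_mod_cast hQ

variable {d : ℕ}

theorem card_filter_pow_dvd_resEval_le_of_polynomial (hd : 1 ≤ d) {p : ℕ} (hp : p.Prime) {Q : ℕ}
    (hQ : ¬ p ∣ Q) (c : Fin (2 * d + 2) → ℤ) (H : ℕ) {i j : Fin (2 * d + 2)} (hij : j ≠ i)
    (hpoly : ∀ C : Fin (2 * d + 2) → ℤ, ∃ P : Polynomial ℤ, P.natDegree ≤ d ∧
      P.coeff d = C j ^ d ∧ ∀ t, P.eval t = resEval d (Function.update C i t)) :
    ((cube (Fin (2 * d + 2)) H).filter fun g => ¬ (p : ℤ) ∣ cosetPoint c Q g j ∧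
      (p : ℤ) ^ (2 * d) ∣ resEval d (cosetPoint c Q g)).card ≤
      d * ((2 * H + 1) / p ^ 2 + 1) * (2 * H + 1) ^ (2 * d + 1) := by
  have hp' : Prime (p : ℤ) := Nat.prime_iff_prime_int.1 hp
  have hQ' : ¬ (p : ℤ) ∣ Q := by exact_mod_cast hQ
  have hQ0 : (Q : ℤ) ≠ 0 := by rintro h; exact hQ' (h ▸ dvd_zero _)
  have := card_le_of_card_fiber_le i H (d * ((2 * H + 1) / p ^ 2 + 1)) _
    (Finset.filter_subset (fun g => ¬ (p : ℤ) ∣ cosetPoint c Q g j ∧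
      (p : ℤ) ^ (2 * d) ∣ resEval d (cosetPoint c Q g)) (cube (Fin (2 * d + 2)) H)) ?_
  · simpa using this
  intro g
  by_cases hg : (p : ℤ) ∣ cosetPoint c Q g j
  · rw [Finset.filter_eq_empty_iff.2]
    · simp
    · intro t _ ht
      apply (Finset.mem_filter.1 ht).2.1
      rwa [cosetPoint_update, Function.update_of_ne hij]
  · obtain ⟨P, hPd, hPc, hPe⟩ := hpoly (cosetPoint c Q g)
    obtain ⟨h1, h2⟩ := natDegree_comp_affine_le hPd (c i) hQ0
    refine (Finset.card_le_card ?_).trans (card_filter_pow_dvd_eval_le hp d _ h1 ?_ H)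
    · intro t ht
      rw [Finset.mem_filter] at ht ⊢
      refine ⟨ht.1, ?_⟩
      have h3 := (Finset.mem_filter.1 ht.2).2.2
      rw [cosetPoint_update, ← hPe] at h3
      simp only [Polynomial.eval_comp, Polynomial.eval_add, Polynomial.eval_mul, Polynomial.eval_C,
        Polynomial.eval_X]
      exact (pow_dvd_pow _ (by omega)).trans h3
    · rw [h2, hPc]
      intro h
      rcases hp'.dvd_or_dvd h with h | h
      · exact hg (hp'.dvd_of_dvd_pow h)
      · exact hQ' (hp'.dvd_of_dvd_pow h)

theorem card_filter_pow_dvd_resEval_le (hd : 1 ≤ d) {p : ℕ} (hp : p.Prime) {Q : ℕ}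
    (hQ : ¬ p ∣ Q) (c : Fin (2 * d + 2) → ℤ) (H : ℕ) :
    ((cube (Fin (2 * d + 2)) H).filter fun g =>
      (p : ℤ) ^ (2 * d) ∣ resEval d (cosetPoint c Q g)).card ≤
      2 * (d * ((2 * H + 1) / p ^ 2 + 1) * (2 * H + 1) ^ (2 * d + 1)) +
        ((2 * H + 1) / p + 1) ^ 2 * (2 * H + 1) ^ (2 * d) := by
  have h0 : (0 : Fin (2 * d + 2)) ≠ Fin.last _ := Fin.last_pos.ne
  have h1 := card_filter_pow_dvd_resEval_le_of_polynomial hd hp hQ c H h0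
    (exists_polynomial_update_last d)
  have h2 := card_filter_pow_dvd_resEval_le_of_polynomial hd hp hQ c H h0.symm
    (exists_polynomial_update_zero d)
  have h3 := card_le_of_two_coordinates h0 H _ _ _
    (card_filter_dvd_affine_le hp hQ (c 0) H) (card_filter_dvd_affine_le hp hQ (c (Fin.last _)) H)
  rw [Fintype.card_fin, Nat.add_sub_cancel] at h3
  have h4 : ((cube (Fin (2 * d + 2)) H).filter fun g =>
      (p : ℤ) ^ (2 * d) ∣ resEval d (cosetPoint c Q g)) ⊆
      ((cube (Fin (2 * d + 2)) H).filter fun g => ¬ (p : ℤ) ∣ cosetPoint c Q g 0 ∧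
        (p : ℤ) ^ (2 * d) ∣ resEval d (cosetPoint c Q g)) ∪
      (((cube (Fin (2 * d + 2)) H).filter fun g => ¬ (p : ℤ) ∣ cosetPoint c Q g (Fin.last _) ∧
        (p : ℤ) ^ (2 * d) ∣ resEval d (cosetPoint c Q g)) ∪
      ((cube (Fin (2 * d + 2)) H).filter fun g => (p : ℤ) ∣ Q * g 0 + c 0 ∧
        (p : ℤ) ∣ Q * g (Fin.last _) + c (Fin.last _))) := by
    intro g hg
    rw [Finset.mem_filter] at hg
    rw [Finset.mem_union, Finset.mem_union, Finset.mem_filter, Finset.mem_filter, Finset.mem_filter]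
    by_cases ha : (p : ℤ) ∣ cosetPoint c Q g 0
    · by_cases hb : (p : ℤ) ∣ cosetPoint c Q g (Fin.last _)
      · exact Or.inr (Or.inr ⟨hg.1, ha, hb⟩)
      · exact Or.inr (Or.inl ⟨hg.1, hb, hg.2⟩)
    · exact Or.inl ⟨hg.1, ha, hg.2⟩
  have h5 := (Finset.card_le_card h4).trans ((Finset.card_union_le _ _).trans
    (Nat.add_le_add_left (Finset.card_union_le _ _) _))
  omega

theorem card_filter_pow_dvd_resEval_le_real (hd : 1 ≤ d) {p : ℕ} (hp : p.Prime) {Q : ℕ}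
    (hQ : ¬ p ∣ Q) (c : Fin (2 * d + 2) → ℤ) (H : ℕ) :
    (((cube (Fin (2 * d + 2)) H).filter fun g =>
      (p : ℤ) ^ (2 * d) ∣ resEval d (cosetPoint c Q g)).card : ℝ) ≤
      (2 * d + 2) * (((p : ℝ) ^ 2)⁻¹ + (2 * H + 1 : ℝ)⁻¹) * (2 * H + 1 : ℝ) ^ (2 * d + 2) := by
  have h := card_filter_pow_dvd_resEval_le hd hp hQ c H
  have h' : (((cube (Fin (2 * d + 2)) H).filter fun g =>
      (p : ℤ) ^ (2 * d) ∣ resEval d (cosetPoint c Q g)).card : ℝ) ≤ _ := Nat.cast_le.2 h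
  refine h'.trans ?_
  push_cast
  have e1 : (((2 * H + 1) / p ^ 2 : ℕ) : ℝ) ≤ (2 * H + 1 : ℝ) * ((p : ℝ) ^ 2)⁻¹ := by
    have := Nat.cast_div_le (α := ℝ) (m := 2 * H + 1) (n := p ^ 2)
    push_cast at this
    rwa [div_eq_mul_inv] at this
  have e2 : (((2 * H + 1) / p : ℕ) : ℝ) ≤ (2 * H + 1 : ℝ) * (p : ℝ)⁻¹ := by
    have := Nat.cast_div_le (α := ℝ) (m := 2 * H + 1) (n := p)
    push_cast at this
    rwa [div_eq_mul_inv] at this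
  have hL : (1 : ℝ) ≤ 2 * H + 1 := by
    have : (0 : ℝ) ≤ H := Nat.cast_nonneg H
    linarith
  set L : ℝ := 2 * H + 1 with hLdef
  grw [e1, e2]
  have hL0 : L ≠ 0 := by positivity
  have hLi : L * L⁻¹ = 1 := mul_inv_cancel₀ hL0
  have e3 : (L * (p : ℝ)⁻¹ + 1) ^ 2 ≤ 2 * (L ^ 2 * ((p : ℝ) ^ 2)⁻¹ + L) := by
    have : 0 ≤ (L * (p : ℝ)⁻¹ - 1) ^ 2 := sq_nonneg _
    have e : (L * (p : ℝ)⁻¹) ^ 2 = L ^ 2 * ((p : ℝ) ^ 2)⁻¹ := by rw [mul_pow, inv_pow]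
    nlinarith
  grw [e3]
  apply le_of_eq
  have e4 : ((p : ℝ) ^ 2)⁻¹ + L⁻¹ = (L * ((p : ℝ) ^ 2)⁻¹ + 1) * L⁻¹ := by
    rw [add_mul, mul_right_comm, hLi]; ring
  have e5 : L⁻¹ * L ^ (2 * d + 2) = L ^ (2 * d + 1) := by
    rw [pow_succ' L (2 * d + 1), ← mul_assoc, inv_mul_cancel₀ hL0, one_mul]
  rw [e4]
  linear_combination (-(2 * (d : ℝ) + 2) * (L * ((p : ℝ) ^ 2)⁻¹ + 1)) * e5

end PrimeCount

section Tail

theorem eventually_primeCounting_le_mul {ε : ℝ} (hε : 0 < ε) :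
    ∀ᶠ x : ℝ in atTop, (Nat.primeCounting ⌊x⌋₊ : ℝ) ≤ ε * x := by
  filter_upwards [Chebyshev.eventually_primeCounting_le one_pos,
    Real.tendsto_log_atTop.eventually_ge_atTop ((Real.log 4 + 1) / ε),
    Real.tendsto_log_atTop.eventually_gt_atTop 0, eventually_ge_atTop 0] with x h1 h2 h3 h4
  refine h1.trans ?_
  rw [div_le_iff₀ h3]
  rw [div_le_iff₀ hε] at h2
  nlinarith

theorem eventually_card_filter_prime_le {k : ℕ} (hk : 1 ≤ k) {η : ℝ} (hη : 0 < η) :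
    ∀ᶠ H : ℕ in atTop,
      (Nat.primeCounting (k * (2 * H + 1)) : ℝ) ≤ η * (2 * H + 1) := by
  have hk' : (0 : ℝ) < k := by exact_mod_cast hk
  have ht : Tendsto (fun H : ℕ => ((k * (2 * H + 1) : ℕ) : ℝ)) atTop atTop := by
    refine tendsto_natCast_atTop_atTop.comp (tendsto_atTop_mono (fun H => ?_) tendsto_id)
    simp only [id]
    nlinarith
  filter_upwards [ht.eventually (eventually_primeCounting_le_mul (div_pos hη hk'))] with H h
  rw [Nat.floor_natCast] at h
  refine h.trans (le_of_eq ?_)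
  push_cast
  field_simp

theorem sum_prime_inv_sq_le {M B : ℕ} (hM : 1 ≤ M) :
    ∑ p ∈ (Finset.Ioc M B).filter Nat.Prime, ((p : ℝ) ^ 2)⁻¹ ≤ (M : ℝ)⁻¹ := by
  rcases le_total M B with h | h
  · refine (Finset.sum_le_sum_of_subset_of_nonneg (Finset.filter_subset _ _)
      fun _ _ _ => by positivity).trans ?_
    refine (sum_Ioc_inv_sq_le_sub (by omega) h).trans ?_
    simp
  · rw [Finset.Ioc_eq_empty (by omega)]
    simp

theorem abs_cosetPoint_le {ι : Type*} [Fintype ι] [DecidableEq ι] (c : ι → ℤ) (Q : ℕ) {H : ℕ}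
    {g : ι → ℤ} (hg : g ∈ cube ι H) (i : ι) :
    |cosetPoint c Q g i| ≤ (((Q + ∑ j, (c j).natAbs + 1) * (2 * H + 1) : ℕ) : ℤ) := by
  have h1 : |g i| ≤ H := by
    have := Finset.mem_Icc.1 (Fintype.mem_piFinset.1 hg i)
    exact abs_le.2 this
  have h2 : |c i| ≤ ((∑ j, (c j).natAbs : ℕ) : ℤ) := by
    rw [Int.abs_eq_natAbs]
    exact_mod_cast Finset.single_le_sum (f := fun j => (c j).natAbs) (fun _ _ => Nat.zero_le _)
      (Finset.mem_univ i)
  have h3 : |cosetPoint c Q g i| ≤ Q * |g i| + |c i| := by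
    refine (abs_add_le _ _).trans ?_
    rw [abs_mul, Nat.abs_cast]
  push_cast at h2 ⊢
  have h4 : (0 : ℤ) ≤ ∑ j, |c j| := Finset.sum_nonneg fun _ _ => abs_nonneg _
  have h5 : (Q : ℤ) * |g i| ≤ Q * H := mul_le_mul_of_nonneg_left h1 (Nat.cast_nonneg _)
  have h6 : (0 : ℤ) ≤ H := Nat.cast_nonneg _
  have h7 : (0 : ℤ) ≤ Q := Nat.cast_nonneg _
  nlinarith [mul_nonneg h7 h6, mul_nonneg h4 h6]

variable {d : ℕ}

theorem exists_prime_le_of_pow_dvd_resEval (hd : 1 ≤ d) (c : Fin (2 * d + 2) → ℤ) (Q : ℕ) {M : ℕ} :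
    ∃ k : ℕ, 1 ≤ k ∧ ∀ᶠ H : ℕ in atTop, ∀ g ∈ cube (Fin (2 * d + 2)) H,
      (∃ p : ℕ, p.Prime ∧ M < p ∧ (p : ℤ) ^ (2 * d) ∣ resEval d (cosetPoint c Q g)) →
      ∃ p ∈ (Finset.Ioc M (k * (2 * H + 1))).filter Nat.Prime,
        (p : ℤ) ^ (2 * d) ∣ resEval d (cosetPoint c Q g) := by
  obtain ⟨q, hqM, hq⟩ := Nat.exists_infinite_primes (M + 1)
  set e := Q + ∑ j, (c j).natAbs + 1 with he
  set F := (2 * d).factorial with hF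
  have hF1 : 1 ≤ F := Nat.factorial_pos _
  refine ⟨F * e, Nat.mul_pos hF1 (Nat.succ_pos _), ?_⟩
  filter_upwards [eventually_ge_atTop q] with H hH g hg ⟨p, hp, hMp, hdvd⟩
  by_cases h0 : resEval d (cosetPoint c Q g) = 0
  · refine ⟨q, ?_, by rw [h0]; exact dvd_zero _⟩
    rw [Finset.mem_filter, Finset.mem_Ioc]
    refine ⟨⟨by omega, ?_⟩, hq⟩
    have : 1 ≤ F * e := Nat.mul_pos hF1 (Nat.succ_pos _)
    nlinarith
  · refine ⟨p, ?_, hdvd⟩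
    rw [Finset.mem_filter, Finset.mem_Ioc]
    refine ⟨⟨hMp, ?_⟩, hp⟩
    have h1 := abs_resEval_le d (abs_cosetPoint_le c Q hg)
    have h2 := Int.le_of_dvd (abs_pos.2 h0) ((dvd_abs _ _).2 hdvd)
    have h3 : p ^ (2 * d) ≤ F * (e * (2 * H + 1)) ^ (2 * d) := by
      exact_mod_cast h2.trans h1
    have h4 : F * (e * (2 * H + 1)) ^ (2 * d) ≤ (F * e * (2 * H + 1)) ^ (2 * d) := by
      rw [mul_assoc F, mul_pow F]
      exact Nat.mul_le_mul_right _ (Nat.le_self_pow (by omega) _)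
    exact le_of_pow_le_pow_left₀ (by omega) (Nat.zero_le _) (h3.trans h4)

open Classical in
theorem eventually_card_tail_le (hd : 1 ≤ d) {M Q : ℕ} (hM : 1 ≤ M)
    (hQ : ∀ p : ℕ, p.Prime → M < p → ¬ p ∣ Q) (c : Fin (2 * d + 2) → ℤ) {η : ℝ} (hη : 0 < η) :
    ∀ᶠ H : ℕ in atTop, (((cube (Fin (2 * d + 2)) H).filter fun g =>
      ∃ p : ℕ, p.Prime ∧ M < p ∧ (p : ℤ) ^ (2 * d) ∣ resEval d (cosetPoint c Q g)).card : ℝ) ≤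
      ((2 * d + 2) / M + η) * (2 * H + 1 : ℝ) ^ (2 * d + 2) := by
  obtain ⟨k, hk, hev⟩ := exists_prime_le_of_pow_dvd_resEval hd c Q (M := M)
  have hd2 : (0 : ℝ) < 2 * d + 2 := by positivity
  filter_upwards [hev, eventually_card_filter_prime_le hk (div_pos hη hd2)] with H h1 h2
  set P := (Finset.Ioc M (k * (2 * H + 1))).filter Nat.Prime with hP
  have hL : (0 : ℝ) < 2 * H + 1 := by positivity
  have hPc : (P.card : ℝ) ≤ η / (2 * d + 2) * (2 * H + 1) := by
    refine le_trans ?_ h2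
    rw [← Nat.primesLE_card_eq_primeCounting]
    refine Nat.cast_le.2 (Finset.card_le_card fun p hp => ?_)
    simp only [hP, Finset.mem_filter, Finset.mem_Ioc] at hp
    exact Nat.mem_primesLE.2 ⟨hp.1.2, hp.2⟩
  have hsub : ((cube (Fin (2 * d + 2)) H).filter fun g =>
      ∃ p : ℕ, p.Prime ∧ M < p ∧ (p : ℤ) ^ (2 * d) ∣ resEval d (cosetPoint c Q g)) ⊆
      P.biUnion fun p => (cube (Fin (2 * d + 2)) H).filter fun g =>
        (p : ℤ) ^ (2 * d) ∣ resEval d (cosetPoint c Q g) := by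
    intro g hg
    rw [Finset.mem_filter] at hg
    obtain ⟨p, hp, hdvd⟩ := h1 g hg.1 hg.2
    exact Finset.mem_biUnion.2 ⟨p, hp, Finset.mem_filter.2 ⟨hg.1, hdvd⟩⟩
  calc _ ≤ ((∑ p ∈ P, ((cube (Fin (2 * d + 2)) H).filter fun g =>
        (p : ℤ) ^ (2 * d) ∣ resEval d (cosetPoint c Q g)).card : ℕ) : ℝ) :=
        Nat.cast_le.2 ((Finset.card_le_card hsub).trans Finset.card_biUnion_le)
    _ ≤ ∑ p ∈ P, (2 * d + 2) * (((p : ℝ) ^ 2)⁻¹ + (2 * H + 1 : ℝ)⁻¹) *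
        (2 * H + 1 : ℝ) ^ (2 * d + 2) := by
        push_cast
        refine Finset.sum_le_sum fun p hp => ?_
        simp only [hP, Finset.mem_filter, Finset.mem_Ioc] at hp
        convert card_filter_pow_dvd_resEval_le_real hd hp.2 (hQ p hp.2 hp.1.1) c H
    _ = (2 * d + 2) * (∑ p ∈ P, ((p : ℝ) ^ 2)⁻¹ + P.card * (2 * H + 1 : ℝ)⁻¹) *
        (2 * H + 1 : ℝ) ^ (2 * d + 2) := by
        rw [← Finset.sum_mul, ← Finset.mul_sum, Finset.sum_add_distrib, Finset.sum_const,
          nsmul_eq_mul]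
    _ ≤ (2 * d + 2) * ((M : ℝ)⁻¹ + η / (2 * d + 2) * (2 * H + 1) * (2 * H + 1 : ℝ)⁻¹) *
        (2 * H + 1 : ℝ) ^ (2 * d + 2) := by
        gcongr
        exact sum_prime_inv_sq_le hM
    _ = _ := by
        have hM' : (M : ℝ) ≠ 0 := by positivity
        field_simp

end Tail

section Density

open Classical in
/-- The proportion of points of `A` in the cube `[-H, H] ^ ι`. -/
def cubeRatio {ι : Type*} [Fintype ι] [DecidableEq ι] (A : Set (ι → ℤ)) (H : ℕ) : ℝ :=
  ((cube ι H).filter (· ∈ A)).card / (2 * H + 1 : ℝ) ^ Fintype.card ι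

theorem tendsto_card_residue_div {N : ℕ} (hN : 0 < N) (v : ℤ) :
    Tendsto (fun H : ℕ => (((symIcc H).filter fun t : ℤ => t ≡ v [ZMOD N]).card : ℝ) / (2 * H + 1))
      atTop (nhds (1 / N)) := by
  have hN' : (0 : ℤ) < N := by exact_mod_cast hN
  have hbound : ∀ H : ℕ, |(((symIcc H).filter fun t : ℤ => t ≡ v [ZMOD N]).card : ℝ) -
      (2 * H + 1) / N| ≤ 1 := by
    intro H
    have hIcc : symIcc H = Finset.Ioc (-(H : ℤ) - 1) H := by
      ext t
      simp only [symIcc, Finset.mem_Icc, Finset.mem_Ioc]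
      omega
    have hcard := Int.Ioc_filter_modEq_card (-(H : ℤ) - 1) H hN' v
    rw [← hIcc] at hcard
    set m := ((symIcc H).filter fun t : ℤ => t ≡ v [ZMOD N]).card
    have h1 := Int.floor_le (((H - v : ℤ) : ℚ) / (N : ℤ))
    have h2 := Int.lt_floor_add_one (((H - v : ℤ) : ℚ) / (N : ℤ))
    have h3 := Int.floor_le (((-(H : ℤ) - 1 - v : ℤ) : ℚ) / (N : ℤ))
    have h4 := Int.lt_floor_add_one (((-(H : ℤ) - 1 - v : ℤ) : ℚ) / (N : ℤ))
    have hNq : (0 : ℚ) < N := by exact_mod_cast hN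
    have hdiff : ((H - v : ℤ) : ℚ) / (N : ℤ) - ((-(H : ℤ) - 1 - v : ℤ) : ℚ) / (N : ℤ) =
        (2 * H + 1) / N := by
      push_cast
      field_simp
      ring
    push_cast at hcard h1 h2 h3 h4 hdiff
    have hpos : (0 : ℚ) ≤ (2 * H + 1) / N := by positivity
    have hcardq : ((m : ℤ) : ℚ) = _ := congrArg (Int.cast : ℤ → ℚ) hcard
    have key : |(m : ℚ) - (2 * H + 1) / N| ≤ 1 := by
      rw [abs_le]
      push_cast at hcardq
      rw [hcardq]
      constructor
      · have := le_max_left ((⌊((H : ℚ) - v) / N⌋ : ℚ) - ⌊(-(H : ℚ) - 1 - v) / N⌋) 0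
        linarith
      · rcases max_choice ((⌊((H : ℚ) - v) / N⌋ : ℚ) - ⌊(-(H : ℚ) - 1 - v) / N⌋) 0 with h | h <;>
          rw [h] <;> linarith
    have keyr := (Rat.cast_le (K := ℝ)).2 key
    push_cast at keyr
    exact keyr
  have h0 : Tendsto (fun H : ℕ => (1 : ℝ) / (2 * H + 1)) atTop (nhds 0) := by
    have := tendsto_one_div_add_atTop_nhds_zero_nat (𝕜 := ℝ)
    refine squeeze_zero (fun _ => by positivity) (fun H => ?_) this
    gcongr
    have : (0 : ℝ) ≤ H := Nat.cast_nonneg H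
    linarith
  rw [tendsto_iff_dist_tendsto_zero]
  refine squeeze_zero (fun _ => dist_nonneg) (fun H => ?_) h0
  have hL : (0 : ℝ) < 2 * H + 1 := by positivity
  rw [Real.dist_eq, le_div_iff₀ hL, ← abs_of_pos hL, ← abs_mul, abs_of_pos hL, sub_mul,
    div_mul_cancel₀ _ hL.ne', one_div_mul_eq_div]
  exact hbound H

open Classical in
theorem exists_tendsto_cubeRatio_of_periodic {ι : Type*} [Fintype ι] [DecidableEq ι] {N : ℕ}
    (hN : 0 < N) (A : Set (ι → ℤ))
    (hA : ∀ g h : ι → ℤ, (∀ i, (g i : ZMod N) = h i) → g ∈ A → h ∈ A) :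
    ∃ δ, Tendsto (cubeRatio A) atTop (nhds δ) := by
  have : NeZero N := ⟨hN.ne'⟩
  set R : Finset (ι → ZMod N) := Finset.univ.filter fun ρ => (fun i => ((ρ i).val : ℤ)) ∈ A with hR
  have hcount : ∀ H : ℕ, ((cube ι H).filter (· ∈ A)).card = ∑ ρ ∈ R,
      ∏ i, ((symIcc H).filter fun t : ℤ => t ≡ (ρ i).val [ZMOD N]).card := by
    intro H
    have hval : ∀ (g : ι → ℤ) i, (g i : ZMod N) = ((((g i : ZMod N).val : ℕ) : ℤ) : ZMod N) := by
      intro g i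
      simp
    rw [Finset.card_eq_sum_card_fiberwise (f := fun g i => (g i : ZMod N)) (t := R)]
    · refine Finset.sum_congr rfl fun ρ hρ => ?_
      rw [← Fintype.card_piFinset]
      congr 1
      ext g
      simp only [Finset.mem_filter, Fintype.mem_piFinset, ← ZMod.intCast_eq_intCast_iff]
      constructor
      · rintro ⟨⟨h1, _⟩, rfl⟩ i
        exact ⟨h1 i, hval g i⟩
      · intro h
        have he : ∀ i, (g i : ZMod N) = ρ i := fun i => by simpa using (h i).2
        refine ⟨⟨fun i => (h i).1, ?_⟩, funext he⟩
        exact hA _ _ (fun i => (h i).2.symm) (Finset.mem_filter.1 hρ).2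
    · intro g hg
      have hgA := (Finset.mem_filter.1 hg).2
      exact Finset.mem_filter.2 ⟨Finset.mem_univ _, hA _ _ (hval g) hgA⟩
  refine ⟨∑ ρ ∈ R, ∏ i : ι, (1 / N : ℝ), ?_⟩
  have hlim : Tendsto (fun H : ℕ => ∑ ρ ∈ R, ∏ i, ((((symIcc H).filter
      fun t : ℤ => t ≡ (ρ i).val [ZMOD N]).card : ℝ) / (2 * H + 1))) atTop
      (nhds (∑ ρ ∈ R, ∏ i : ι, (1 / N : ℝ))) :=
    tendsto_finsetSum _ fun ρ _ => tendsto_finsetProd _ fun i _ =>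
      tendsto_card_residue_div hN ((ρ i).val : ℤ)
  refine hlim.congr fun H => ?_
  unfold cubeRatio
  rw [show ((cube ι H).filter (· ∈ A)).card = _ from hcount H]
  push_cast
  rw [Finset.sum_div]
  refine Finset.sum_congr rfl fun ρ _ => ?_
  rw [Finset.prod_div_distrib, Finset.prod_const, Finset.card_univ]

theorem cubeRatio_mono {ι : Type*} [Fintype ι] [DecidableEq ι] {A B : Set (ι → ℤ)}
    (h : A ⊆ B) (H : ℕ) : cubeRatio A H ≤ cubeRatio B H := by
  unfold cubeRatio
  gcongr

theorem cubeRatio_le_add {ι : Type*} [Fintype ι] [DecidableEq ι] {A B T : Set (ι → ℤ)}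
    (h : B ⊆ A ∪ T) (H : ℕ) : cubeRatio B H ≤ cubeRatio A H + cubeRatio T H := by
  classical
  unfold cubeRatio
  rw [← add_div]
  gcongr
  rw [← Nat.cast_add]
  refine Nat.cast_le.2 ((Finset.card_le_card ?_).trans (Finset.card_union_le _ _))
  intro g hg
  rw [Finset.mem_union, Finset.mem_filter, Finset.mem_filter]
  obtain ⟨h1, h2⟩ := Finset.mem_filter.1 hg
  exact (h h2).imp (fun h => ⟨h1, h⟩) fun h => ⟨h1, h⟩

/-- A set approximated from above by sets having a density, with an error of small upper density,
has a density. -/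
theorem exists_tendsto_cubeRatio_of_approx {ι : Type*} [Fintype ι] [DecidableEq ι] (A : Set (ι → ℤ))
    (B T : ℕ → Set (ι → ℤ)) (hAB : ∀ M, A ⊆ B M) (hBT : ∀ M, B M ⊆ A ∪ T M)
    (hB : ∀ M, ∃ δ, Tendsto (cubeRatio (B M)) atTop (nhds δ))
    (hT : ∀ ε > 0, ∃ M, ∀ᶠ H in atTop, cubeRatio (T M) H ≤ ε) :
    ∃ δ, Tendsto (cubeRatio A) atTop (nhds δ) := by
  refine cauchySeq_tendsto_of_complete (Metric.cauchySeq_iff'.2 fun ε hε => ?_)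
  obtain ⟨M, hM⟩ := hT (ε / 4) (by positivity)
  obtain ⟨δ, hδ⟩ := hB M
  obtain ⟨N, hN⟩ := eventually_atTop.1
    (hM.and (Metric.tendsto_nhds.1 hδ (ε / 4) (by positivity)))
  have key : ∀ H ≥ N, δ - ε / 2 < cubeRatio A H ∧ cubeRatio A H < δ + ε / 4 := by
    intro H hH
    obtain ⟨h1, h2⟩ := hN H hH
    rw [Real.dist_eq, abs_lt] at h2
    have h3 := cubeRatio_mono (hAB M) H
    have h4 := cubeRatio_le_add (hBT M) H
    constructor <;> linarith
  refine ⟨N, fun H hH => ?_⟩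
  have h1 := key H hH
  have h2 := key N le_rfl
  rw [Real.dist_eq, abs_lt]
  constructor <;> linarith

end Density

section Sieve

variable {d : ℕ}

/-- The tuples, of either sign, whose resultant is `2d`-power free and prime to `Sig`. -/
def powerFreeTuples (d : ℕ) (Sig : Finset ℕ) : Set (Fin (2 * d + 2) → ℤ) :=
  {C | (∀ p ∈ Sig, ¬ (p : ℤ) ∣ resEval d C) ∧
    ∀ p : ℕ, p.Prime → ¬ (p : ℤ) ^ (2 * d) ∣ resEval d C}

/-- The integer tuples with no common prime factor. -/
def primitiveTuples (d : ℕ) : Set (Fin (2 * d + 2) → ℤ) :=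
  {C | ∀ p : ℕ, p.Prime → ¬ ∀ i, (p : ℤ) ∣ C i}

/-- The points of the coset `c + Q ℤ ^ (2d + 2)` at which the resultant is divisible by `p ^ 2d`
for some prime `p > M`. -/
def resTail (d : ℕ) (c : Fin (2 * d + 2) → ℤ) (Q M : ℕ) : Set (Fin (2 * d + 2) → ℤ) :=
  {g | ∃ p : ℕ, p.Prime ∧ M < p ∧ (p : ℤ) ^ (2 * d) ∣ resEval d (cosetPoint c Q g)}

theorem eventually_cubeRatio_resTail_le (hd : 1 ≤ d) {M Q : ℕ} (hM : 1 ≤ M)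
    (hQ : ∀ p : ℕ, p.Prime → M < p → ¬ p ∣ Q) (c : Fin (2 * d + 2) → ℤ) {η : ℝ} (hη : 0 < η) :
    ∀ᶠ H : ℕ in atTop, cubeRatio (resTail d c Q M) H ≤ (2 * d + 2) / M + η := by
  filter_upwards [eventually_card_tail_le hd hM hQ c hη] with H h
  unfold cubeRatio
  rw [Fintype.card_fin, div_le_iff₀ (by positivity)]
  exact h

theorem cosetPoint_zero_one {ι : Type*} (g : ι → ℤ) : cosetPoint 0 1 g = g := by
  ext i
  simp [cosetPoint]

theorem exists_eventually_cubeRatio_resTail_le (hd : 1 ≤ d) {ε : ℝ} (hε : 0 < ε) :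
    ∃ M, ∀ᶠ H in atTop, cubeRatio (resTail d 0 1 (M + 1)) H ≤ ε := by
  obtain ⟨M, hM⟩ := exists_nat_gt ((2 * d + 2) / (ε / 2))
  refine ⟨M, (eventually_cubeRatio_resTail_le hd (by omega) (fun p hp _ h => hp.one_lt.ne'
    (Nat.dvd_one.1 h)) 0 (half_pos hε)).mono fun H h => h.trans ?_⟩
  have h1 : (2 * d + 2 : ℝ) / ((M + 1 : ℕ) : ℝ) ≤ ε / 2 := by
    rw [div_lt_iff₀ (half_pos hε)] at hM
    rw [div_le_iff₀ (by positivity)]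
    push_cast
    nlinarith
  linarith

theorem dvd_resEval_of_modEq {N k : ℕ} (hk : k ∣ N) {C D : Fin (2 * d + 2) → ℤ}
    (h : ∀ i, (C i : ZMod N) = D i) (hC : (k : ℤ) ∣ resEval d C) : (k : ℤ) ∣ resEval d D := by
  have h1 := (ZMod.intCast_eq_intCast_iff_dvd_sub _ _ _).1 (resEval_modEq d h)
  have h2 : (k : ℤ) ∣ resEval d D - resEval d C := (Int.natCast_dvd_natCast.2 hk).trans h1
  exact (Int.dvd_iff_dvd_of_dvd_sub h2).2 hC

theorem exists_tendsto_cubeRatio_powerFreeTuples (hd : 1 ≤ d) {Sig : Finset ℕ}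
    (hSig : ∀ p ∈ Sig, Nat.Prime p) :
    ∃ δ, Tendsto (cubeRatio (powerFreeTuples d Sig)) atTop (nhds δ) := by
  refine exists_tendsto_cubeRatio_of_approx _
    (fun M => {C | (∀ p ∈ Sig, ¬ (p : ℤ) ∣ resEval d C) ∧
      ∀ p : ℕ, p.Prime → p ≤ M + 1 → ¬ (p : ℤ) ^ (2 * d) ∣ resEval d C})
    (fun M => resTail d 0 1 (M + 1)) (fun M C hC => ⟨hC.1, fun p hp _ => hC.2 p hp⟩) ?_ ?_
    (fun ε hε => exists_eventually_cubeRatio_resTail_le hd hε)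
  · intro M C hC
    by_cases h : ∃ p : ℕ, p.Prime ∧ (p : ℤ) ^ (2 * d) ∣ resEval d C
    · obtain ⟨p, hp, hdvd⟩ := h
      refine Or.inr ⟨p, hp, ?_, by rwa [cosetPoint_zero_one]⟩
      by_contra! hle
      exact hC.2 p hp hle hdvd
    · push Not at h
      exact Or.inl ⟨hC.1, h⟩
  · intro M
    refine exists_tendsto_cubeRatio_of_periodic
      (N := (∏ p ∈ Sig, p) * (M + 1).factorial ^ (2 * d)) ?_ _ ?_
    · exact Nat.mul_pos (Finset.prod_pos fun p hp => (hSig p hp).pos)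
        (pow_pos (Nat.factorial_pos _) _)
    · intro C D hCD hC
      refine ⟨fun p hp h => hC.1 p hp ?_, fun p hp hle h => hC.2 p hp hle ?_⟩
      · exact dvd_resEval_of_modEq (Dvd.dvd.mul_right (Finset.dvd_prod_of_mem _ hp) _)
          (fun i => (hCD i).symm) h
      · have := dvd_resEval_of_modEq (k := p ^ (2 * d)) (Dvd.dvd.mul_left
          (pow_dvd_pow_of_dvd (Nat.dvd_factorial hp.pos hle) _) _) (fun i => (hCD i).symm)
          (by push_cast; exact h)
        push_cast at this
        exact this

theorem exists_tendsto_cubeRatio_primitiveTuples (hd : 1 ≤ d) :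
    ∃ δ, Tendsto (cubeRatio (primitiveTuples d)) atTop (nhds δ) := by
  refine exists_tendsto_cubeRatio_of_approx _
    (fun M => {C | ∀ p : ℕ, p.Prime → p ≤ M + 1 → ¬ ∀ i, (p : ℤ) ∣ C i})
    (fun M => resTail d 0 1 (M + 1)) (fun M C hC p hp _ => hC p hp) ?_ ?_
    (fun ε hε => exists_eventually_cubeRatio_resTail_le hd hε)
  · intro M C hC
    by_cases h : ∃ p : ℕ, p.Prime ∧ ∀ i, (p : ℤ) ∣ C i
    · obtain ⟨p, hp, hdvd⟩ := h
      refine Or.inr ⟨p, hp, ?_, by rw [cosetPoint_zero_one]; exact pow_dvd_resEval d hdvd⟩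
      by_contra! hle
      exact hC p hp hle hdvd
    · exact Or.inl fun p hp hdvd => h ⟨p, hp, hdvd⟩
  · intro M
    refine exists_tendsto_cubeRatio_of_periodic (Nat.factorial_pos (M + 1)) _ ?_
    intro C D hCD hC p hp hle h
    refine hC p hp hle fun i => ?_
    have h1 := (ZMod.intCast_eq_intCast_iff_dvd_sub _ _ _).1 (hCD i)
    have h2 : (p : ℤ) ∣ D i - C i :=
      (Int.natCast_dvd_natCast.2 (Nat.dvd_factorial hp.pos hle)).trans h1
    exact (Int.dvd_iff_dvd_of_dvd_sub h2).1 (h i)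

theorem abs_powTuple_le (d : ℕ) (i : Fin (2 * d + 2)) : |powTuple d i| ≤ 1 := by
  unfold powTuple
  split_ifs <;> simp

open Classical in
theorem card_coset_le_card_powerFreeTuples (hd : 1 ≤ d) {Sig : Finset ℕ}
    (hSig : ∀ p ∈ Sig, Nat.Prime p) {M : ℕ} (hM : ∀ p ∈ Sig, p ≤ M) (H : ℕ) :
    ((cube (Fin (2 * d + 2)) H).filter (· ∉ resTail d (powTuple d) M.factorial M)).card ≤
      ((cube (Fin (2 * d + 2)) (M.factorial * H + 1)).filter
        (· ∈ powerFreeTuples d Sig)).card := by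
  set Q := M.factorial with hQ
  have hQ0 : (Q : ℤ) ≠ 0 := by exact_mod_cast M.factorial_ne_zero
  have hcop : ∀ p : ℕ, p.Prime → p ≤ M → ∀ g,
      ¬ (p : ℤ) ∣ resEval d (cosetPoint (powTuple d) Q g) := by
    intro p hp hle g h
    have h1 : (p : ℤ) ∣ resEval d (powTuple d) := by
      refine dvd_resEval_of_modEq (N := Q) (Nat.dvd_factorial hp.pos hle) (fun i => ?_) h
      simp [cosetPoint]
    rw [resEval_powTuple] at h1
    exact hp.one_lt.ne' (Nat.dvd_one.1 (by exact_mod_cast h1))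
  refine Finset.card_le_card_of_injOn (cosetPoint (powTuple d) Q) ?_ ?_
  · intro g hg
    obtain ⟨h1, h2⟩ := Finset.mem_filter.1 hg
    refine Finset.mem_filter.2 ⟨Fintype.mem_piFinset.2 fun i => ?_, ?_, ?_⟩
    · have h3 := abs_le.1 (abs_powTuple_le d i)
      have h4 := Finset.mem_Icc.1 (Fintype.mem_piFinset.1 h1 i)
      have h5 : (0 : ℤ) ≤ Q := Nat.cast_nonneg _
      rw [symIcc, Finset.mem_Icc]
      push_cast
      simp only [cosetPoint]
      constructor <;> nlinarith
    · exact fun p hp => hcop p (hSig p hp) (hM p hp) g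
    · intro p hp h
      rcases le_or_gt p M with hle | hlt
      · exact hcop p hp hle g ((dvd_pow_self _ (by omega)).trans h)
      · exact h2 ⟨p, hp, hlt, h⟩
  · intro g _ g' _ h
    ext i
    have := congrFun h i
    simp only [cosetPoint, add_left_inj] at this
    exact mul_left_cancel₀ hQ0 this

theorem pos_of_tendsto_cubeRatio_powerFreeTuples (hd : 1 ≤ d) {Sig : Finset ℕ}
    (hSig : ∀ p ∈ Sig, Nat.Prime p) {δ : ℝ}
    (hδ : Tendsto (cubeRatio (powerFreeTuples d Sig)) atTop (nhds δ)) : 0 < δ := by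
  classical
  set M := Sig.sup id + 4 * (2 * d + 2) with hMdef
  have hM : ∀ p ∈ Sig, p ≤ M := fun p hp => (Finset.le_sup (f := id) hp).trans (by omega)
  have hM1 : 4 * (2 * d + 2) ≤ M := by omega
  set Q := M.factorial with hQ
  have hQ1 : (1 : ℝ) ≤ Q := by exact_mod_cast M.factorial_pos
  have htail := eventually_cubeRatio_resTail_le hd (M := M) (Q := Q) (by omega)
    (fun p hp hlt h => hlt.not_ge (hp.dvd_factorial.1 h)) (powTuple d)
    (η := 1 / 4) (by norm_num)
  have hsub : Tendsto (fun H : ℕ => Q * H + 1) atTop atTop :=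
    tendsto_atTop_mono (fun H => (Nat.le_mul_of_pos_left H M.factorial_pos).trans
      (Nat.le_succ _)) tendsto_id
  have hlow : 0 < (1 / 2 : ℝ) * (1 / (3 * Q)) ^ (2 * d + 2) := by positivity
  refine hlow.trans_le (ge_of_tendsto (hδ.comp hsub) ?_)
  filter_upwards [htail] with H h
  have hMr : (4 * (2 * d + 2) : ℝ) ≤ M := by exact_mod_cast hM1
  have h1 : (2 * d + 2 : ℝ) / M ≤ 1 / 4 := by
    rw [div_le_iff₀ (by positivity)]
    linarith
  have hL : (0 : ℝ) < (2 * H + 1 : ℝ) ^ (2 * d + 2) := by positivity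
  have h2 : cubeRatio (resTail d (powTuple d) Q M) H ≤ 1 / 2 := by linarith
  unfold cubeRatio at h2
  rw [Fintype.card_fin, div_le_iff₀ hL] at h2
  have h3 := Finset.card_filter_add_card_filter_not (s := cube (Fin (2 * d + 2)) H)
    (· ∈ resTail d (powTuple d) Q M)
  rw [card_cube, Fintype.card_fin] at h3
  have h4 := card_coset_le_card_powerFreeTuples hd hSig hM H
  rw [← hQ] at h4
  have h3' := congrArg (Nat.cast : ℕ → ℝ) h3
  have h4' := (Nat.cast_le (α := ℝ)).2 h4
  push_cast at h3'
  have h5 : (1 / 2 : ℝ) * (2 * H + 1 : ℝ) ^ (2 * d + 2) ≤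
      ((cube (Fin (2 * d + 2)) (Q * H + 1)).filter (· ∈ powerFreeTuples d Sig)).card := by
    refine le_trans ?_ h4'
    linarith
  simp only [Function.comp, cubeRatio, Fintype.card_fin]
  rw [le_div_iff₀ (by positivity)]
  refine le_trans ?_ h5
  rw [mul_assoc, ← mul_pow]
  gcongr
  rw [one_div, inv_mul_le_iff₀ (by positivity)]
  push_cast
  have : (0 : ℝ) ≤ H := Nat.cast_nonneg H
  nlinarith [mul_nonneg (sub_nonneg.2 hQ1) this]

end Sieve

section Sign

theorem not_firstPos_iff_firstPos_neg {n : ℕ} {C : Fin n → ℤ} (hC : C ≠ 0) :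
    (¬ ∃ i, 0 < C i ∧ ∀ j, j < i → C j = 0) ↔ ∃ i, 0 < (-C) i ∧ ∀ j, j < i → (-C) j = 0 := by
  simp only [Pi.neg_apply, neg_eq_zero, Left.neg_pos_iff]
  constructor
  · intro h
    obtain ⟨i, hi, hmin⟩ := wellFounded_lt.has_min {i | C i ≠ 0} (Function.ne_iff.1 hC)
    have hz : ∀ j, j < i → C j = 0 := fun j hj => by
      by_contra hne
      exact hmin j hne hj
    refine ⟨i, ?_, hz⟩
    by_contra hle
    exact h ⟨i, lt_of_le_of_ne (not_lt.1 hle) (Ne.symm hi), hz⟩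
  · rintro ⟨i, hi, hz⟩ ⟨k, hk, hz'⟩
    rcases lt_trichotomy i k with h | rfl | h
    · exact hi.ne (hz' i h)
    · exact hi.not_gt hk
    · exact hk.ne' (hz k h)

open Classical in
theorem two_mul_card_firstPos {n : ℕ} {A : Set (Fin n → ℤ)} (h0 : 0 ∉ A)
    (hneg : ∀ C ∈ A, -C ∈ A) {x : ℝ} (hx : 0 ≤ x) :
    2 * Nat.card ↥({C | C ∈ A ∧ ∃ i, 0 < C i ∧ ∀ j, j < i → C j = 0} ∩
      {C | ∀ i, |(C i : ℝ)| ≤ x}) = ((cube (Fin n) ⌊x⌋₊).filter (· ∈ A)).card := by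
  set F := (cube (Fin n) ⌊x⌋₊).filter (· ∈ A) with hF
  have hmem : ∀ C : Fin n → ℤ, C ∈ cube (Fin n) ⌊x⌋₊ ↔ ∀ i, |(C i : ℝ)| ≤ x := by
    intro C
    rw [Fintype.mem_piFinset]
    refine forall_congr' fun i => ?_
    rw [Finset.mem_Icc, ← abs_le, Int.abs_eq_natAbs, Nat.cast_le, Nat.le_floor_iff hx,
      Nat.cast_natAbs, Int.cast_abs]
  have hset : {C | C ∈ A ∧ ∃ i, 0 < C i ∧ ∀ j, j < i → C j = 0} ∩
      {C | ∀ i, |(C i : ℝ)| ≤ x} =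
      ((F.filter fun C => ∃ i, 0 < C i ∧ ∀ j, j < i → C j = 0 : Finset (Fin n → ℤ)) :
        Set (Fin n → ℤ)) := by
    ext C
    rw [Finset.mem_coe, Finset.mem_filter, Finset.mem_filter, hmem]
    exact ⟨fun h => ⟨⟨h.2, h.1.1⟩, h.1.2⟩, fun h => ⟨⟨h.1.2, h.2⟩, h.1.1⟩⟩
  have hFneg : ∀ C ∈ F, -C ∈ F := by
    intro C hC
    rw [hF, Finset.mem_filter, hmem] at hC ⊢
    exact ⟨fun i => by simpa using hC.1 i, hneg C hC.2⟩
  have hF0 : ∀ C ∈ F, C ≠ 0 := by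
    rintro C hC rfl
    exact h0 (Finset.mem_filter.1 hC).2
  rw [hset, Nat.card_coe_set_eq, Set.ncard_coe_finset,
    ← Finset.card_filter_add_card_filter_not (s := F)
      (fun C => ∃ i, 0 < C i ∧ ∀ j, j < i → C j = 0), two_mul]
  congr 1
  refine Finset.card_bij (fun C _ => -C) ?_ (fun C _ D _ h => neg_injective h) ?_
  · intro C hC
    rw [Finset.mem_filter] at hC ⊢
    refine ⟨hFneg C hC.1, ?_⟩
    rw [not_firstPos_iff_firstPos_neg (neg_ne_zero.2 (hF0 C hC.1)), neg_neg]
    exact hC.2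
  · intro C hC
    rw [Finset.mem_filter] at hC
    refine ⟨-C, ?_, neg_neg C⟩
    rw [Finset.mem_filter]
    exact ⟨hFneg C hC.1, (not_firstPos_iff_firstPos_neg (hF0 C hC.1)).1 hC.2⟩

theorem gcd_eq_one_iff_mem_primitiveTuples {d : ℕ} {C : Fin (2 * d + 2) → ℤ} :
    Finset.univ.gcd C = 1 ↔ C ∈ primitiveTuples d := by
  constructor
  · intro h p hp hdvd
    have := Finset.dvd_gcd (s := Finset.univ) (f := C) (a := (p : ℤ)) fun i _ => hdvd i
    rw [h] at this
    exact hp.one_lt.ne' (Nat.dvd_one.1 (by exact_mod_cast this))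
  · intro h
    have h1 : (Finset.univ.gcd C).natAbs = 1 := by
      by_contra hne
      obtain ⟨p, hp, hdvd⟩ := Nat.exists_prime_and_dvd hne
      exact h p hp fun i => (Int.natCast_dvd.2 hdvd).trans (Finset.gcd_dvd (Finset.mem_univ i))
    have h2 : 0 ≤ Finset.univ.gcd C := Int.nonneg_of_normalize_eq_self Finset.normalize_gcd
    omega

theorem powerFreeTuples_subset_primitiveTuples (d : ℕ) (Sig : Finset ℕ) :
    powerFreeTuples d Sig ⊆ primitiveTuples d :=
  fun _ hC p hp h => hC.2 p hp (pow_dvd_resEval d h)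

end Sign

/-- the height density of `W_Σ` exists and is strictly positive. -/
theorem stmt_12 (d : ℕ) (hd : 2 ≤ d) (Sig : Finset ℕ) (hSig : ∀ p ∈ Sig, Nat.Prime p) :
    ∃ L : ℝ, 0 < L ∧
      Tendsto (fun x : ℝ =>
          (Nat.card ↥(WSigma d Sig ∩ {C | ∀ i, |(C i : ℝ)| ≤ x}) : ℝ) /
          (Nat.card ↥(projPts d ∩ {C | ∀ i, |(C i : ℝ)| ≤ x}) : ℝ))
        atTop (nhds L) := by
  have hd1 : 1 ≤ d := by omega
  obtain ⟨δ, hδ⟩ := exists_tendsto_cubeRatio_powerFreeTuples hd1 hSig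
  obtain ⟨π, hπ⟩ := exists_tendsto_cubeRatio_primitiveTuples hd1
  have hδ0 := pos_of_tendsto_cubeRatio_powerFreeTuples hd1 hSig hδ
  have hsub := powerFreeTuples_subset_primitiveTuples d Sig
  have hπ0 : 0 < π := hδ0.trans_le (le_of_tendsto_of_tendsto' hδ hπ (cubeRatio_mono hsub))
  refine ⟨δ / π, div_pos hδ0 hπ0, ?_⟩
  have h0 : (0 : Fin (2 * d + 2) → ℤ) ∉ primitiveTuples d :=
    fun h => h 2 Nat.prime_two fun i => dvd_zero _
  have hW : WSigma d Sig = {C | C ∈ powerFreeTuples d Sig ∧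
      ∃ i, 0 < C i ∧ ∀ j, j < i → C j = 0} := by
    ext C
    exact ⟨fun h => ⟨h.2, h.1.2⟩,
      fun h => ⟨⟨gcd_eq_one_iff_mem_primitiveTuples.2 (hsub h.1), h.2⟩, h.1⟩⟩
  have hP : projPts d = {C | C ∈ primitiveTuples d ∧ ∃ i, 0 < C i ∧ ∀ j, j < i → C j = 0} := by
    ext C
    exact and_congr_left' gcd_eq_one_iff_mem_primitiveTuples
  refine ((hδ.div hπ hπ0.ne').comp tendsto_nat_floor_atTop).congr' ?_
  filter_upwards [eventually_ge_atTop 0] with x hx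
  have h1 := two_mul_card_firstPos (fun h => h0 (hsub h)) (fun C hC => by
    simpa only [powerFreeTuples, Set.mem_ofPred_eq, resEval_neg] using hC) hx
    (A := powerFreeTuples d Sig)
  have h2 := two_mul_card_firstPos h0 (fun C hC => by
    simpa only [primitiveTuples, Set.mem_ofPred_eq, Pi.neg_apply, dvd_neg] using hC) hx
  simp only [Function.comp, Pi.div_apply, cubeRatio]
  rw [hW, hP, ← h1, ← h2, div_div_div_cancel_right₀ (by positivity)]
  push_cast
  rw [mul_div_mul_left _ _ two_ne_zero]
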